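/- arXiv:2411.05208 — 7 statements merged into one kernel-verified Lean document; each statement's English description precedes it below -/
import Mathlib

section
/- Let m ≥ 1, s ≥ 0 be integers, set k = 2^s and n = m + s + 1, and let C be a unitary 2^m × 2^m complex matrix. Define the 2^n × 2^n unitary U = (|0⟩⟨0|)^{⊗(s+1)} ⊗ C + (I_{2^{s+1}} − (|0⟩⟨0|)^{⊗(s+1)}) ⊗ I_{2^m}. For r ∈ {1, …, s+1} let X^{(r)} = I_{2^{r−1}} ⊗ σx ⊗ I_{2^{s+1−r}} ⊗ I_{2^m} denote the Pauli-X operator on qubit r of the (s+1)-qubit ancilla register. Set W_j = X^{(1)} for all j ∈ {1, …, k}, V_j = X^{(ν₂(j)+2)} for j ∈ {1, …, k−1} (where ν₂ is the 2-adic valuation), and V_k = X^{(s+1)}. Then (1/2^n) · Tr[(U W_1 U† V_1)(U W_2 U† V_2) ⋯ (U W_k U† V_k)] = Re(Tr C)/2^m. -/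
open Matrix
open scoped Kronecker

/-- The projector `(|0⟩⟨0|)^{⊗ t}` onto the all-zeros state of a `t`-qubit register,
qubits indexed by `Fin t` with single-qubit state space `Fin 2`. -/
noncomputable def allZeroProj (t : ℕ) :
    Matrix (Fin t → Fin 2) (Fin t → Fin 2) ℂ :=
  fun x y => if x = 0 ∧ y = 0 then 1 else 0

/-- The Pauli-X operator acting on qubit `r` (0-based) of a `t`-qubit register:
`I_{2^r} ⊗ σx ⊗ I_{2^{t-1-r}}`.  Its `(x, y)` entry is `1` exactly when `y` agrees
with `x` on every qubit except qubit `r`, where it is flipped. -/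
noncomputable def pauliXOn (t : ℕ) (r : ℕ) :
    Matrix (Fin t → Fin 2) (Fin t → Fin 2) ℂ :=
  fun x y =>
    if (∀ i : Fin t, (i : ℕ) ≠ r → y i = x i) ∧ (∀ i : Fin t, (i : ℕ) = r → y i = x i + 1)
    then 1 else 0

abbrev QA (s : ℕ) := Fin (s+1) → Fin 2

def qe (s r : ℕ) : QA s := fun c => if (c : ℕ) = r then 1 else 0

def qp (s i : ℕ) : QA s := fun c =>
  if (c : ℕ) = 0 then Fin.ofNat 2 i else Fin.ofNat 2 ((i + 2^((c:ℕ)-1)) / 2^(c:ℕ))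

noncomputable def MM {s N : ℕ} (v : QA s) (f : QA s → Matrix (Fin N) (Fin N) ℂ) :
    Matrix (QA s × Fin N) (QA s × Fin N) ℂ :=
  fun a b => if b.1 = a.1 + v then f a.1 a.2 b.2 else 0

lemma MM_mul {s N : ℕ} (v w : QA s) (f g : QA s → Matrix (Fin N) (Fin N) ℂ) :
    MM v f * MM w g = MM (v + w) (fun x => f x * g (x + v)) := by
  ext ⟨x, i⟩ ⟨y, j⟩
  simp only [MM, Matrix.mul_apply, Fintype.sum_prod_type]
  rw [Finset.sum_eq_single (x + v)]
  · by_cases h : y = x + v + w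
    · simp [h, add_assoc]
    · have h' : ¬ y = x + (v + w) := by rwa [← add_assoc]
      simp [h, h']
  · intro b _ hb
    simp [hb]
  · simp

lemma MM_trace {s N : ℕ} (f : QA s → Matrix (Fin N) (Fin N) ℂ) :
    Matrix.trace (MM 0 f) = ∑ x, Matrix.trace (f x) := by
  simp [Matrix.trace, MM, Fintype.sum_prod_type]

lemma MM_one {s N : ℕ} : (1 : Matrix (QA s × Fin N) (QA s × Fin N) ℂ) = MM 0 (fun _ => 1) := by
  ext ⟨x, i⟩ ⟨y, j⟩
  by_cases h : x = y
  · simp [MM, Matrix.one_apply, h]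
  · have : ¬ y = x := fun h' => h h'.symm
    simp [MM, Matrix.one_apply, h, this]

lemma pauli_MM (s N r : ℕ) :
    pauliXOn (s+1) r ⊗ₖ (1 : Matrix (Fin N) (Fin N) ℂ) = MM (qe s r) (fun _ => 1) := by
  ext ⟨x, i⟩ ⟨y, j⟩
  have : ((∀ i : Fin (s+1), (i : ℕ) ≠ r → y i = x i) ∧
      (∀ i : Fin (s+1), (i : ℕ) = r → y i = x i + 1)) ↔ y = x + qe s r := by
    constructor
    · rintro ⟨h1, h2⟩
      funext c
      by_cases hc : (c:ℕ) = r
      · simp [qe, hc, h2 c hc]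
      · simp [qe, hc, h1 c hc]
    · rintro rfl
      constructor <;> intro c hc <;> simp [qe, hc]
  simp only [Matrix.kroneckerMap_apply, pauliXOn, MM, this]
  split_ifs <;> simp

noncomputable def uu {s N : ℕ} (C : Matrix (Fin N) (Fin N) ℂ) (x : QA s) :
    Matrix (Fin N) (Fin N) ℂ := if x = 0 then C else 1

lemma U_MM (s N : ℕ) (C : Matrix (Fin N) (Fin N) ℂ) :
    allZeroProj (s+1) ⊗ₖ C +
        ((1 : Matrix (Fin (s+1) → Fin 2) (Fin (s+1) → Fin 2) ℂ) - allZeroProj (s+1)) ⊗ₖ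
          (1 : Matrix (Fin N) (Fin N) ℂ) = MM 0 (uu C) := by
  ext ⟨x, i⟩ ⟨y, j⟩
  simp only [Matrix.add_apply, Matrix.kroneckerMap_apply, Matrix.sub_apply, allZeroProj, MM, uu,
    add_zero]
  by_cases hx : x = 0
  · by_cases hy : y = 0
    · subst hy; subst hx; simp
    · have : ¬ (0 : QA s) = y := fun h => hy h.symm
      simp [hx, hy, Matrix.one_apply, this]
  · by_cases hy : y = x
    · subst hy; simp [hx]
    · have : ¬ x = y := fun h => hy h.symm
      simp [hx, hy, Matrix.one_apply, this]

lemma MM_zero_conj {s N : ℕ} (f : QA s → Matrix (Fin N) (Fin N) ℂ) :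
    (MM 0 f)ᴴ = MM 0 (fun x => (f x)ᴴ) := by
  ext ⟨x, i⟩ ⟨y, j⟩
  simp only [Matrix.conjTranspose_apply, MM, add_zero]
  by_cases h : x = y
  · simp [h]
  · have : ¬ y = x := fun h' => h h'.symm
    simp [h, this]

lemma qa_add_self {s : ℕ} (x : QA s) : x + x = 0 := by
  funext c
  have : ∀ a : Fin 2, a + a = 0 := by decide
  exact this (x c)

lemma qa_add_eq_zero {s : ℕ} (x y : QA s) : x + y = 0 ↔ y = x := by
  constructor
  · intro h
    have : x + (x + y) = x := by rw [h, add_zero]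
    rwa [← add_assoc, qa_add_self, zero_add] at this
  · rintro rfl; exact qa_add_self _

lemma ofNat_eq (a b : ℕ) : Fin.ofNat 2 a = Fin.ofNat 2 b ↔ a % 2 = b % 2 := by
  simp [Fin.ext_iff, Fin.ofNat]

lemma ofNat_add (a b : ℕ) : Fin.ofNat 2 (a + b) = Fin.ofNat 2 a + Fin.ofNat 2 b := by
  simp [Fin.ext_iff, Fin.ofNat, Fin.val_add]

lemma val_iff (i r : ℕ) : 2^(r+1) ∣ i + 2^r + 1 ↔ r = padicValNat 2 (i+1) := by
  have hi : i + 1 ≠ 0 := by omega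
  obtain ⟨v, q, hq, h⟩ : ∃ v q, ¬ 2 ∣ q ∧ i + 1 = 2^v * q :=
    Nat.exists_eq_pow_mul_and_not_dvd hi 2 (by norm_num)
  have hv : padicValNat 2 (i+1) = v := by
    rw [h, padicValNat.mul (by positivity) (by rintro rfl; simp at hq), padicValNat.prime_pow,
      padicValNat.eq_zero_of_not_dvd hq, add_zero]
  rw [hv, show i + 2^r + 1 = 2^v * q + 2^r by omega]
  constructor
  · intro hd
    have h1 : 2^r ∣ 2^v * q :=
      (Nat.dvd_add_left (dvd_refl (2^r))).1 ((pow_dvd_pow 2 (Nat.le_succ r)).trans hd)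
    have hle : r ≤ v := by
      by_contra hlt
      push Not at hlt
      apply hq
      have : 2^v * 2 ∣ 2^v * q := by
        rw [← pow_succ]; exact (pow_dvd_pow 2 hlt).trans h1
      exact Nat.dvd_of_mul_dvd_mul_left (by positivity) this
    by_contra hne
    have hlt : r + 1 ≤ v := by omega
    have h2 : 2^(r+1) ∣ 2^v * q := (pow_dvd_pow 2 hlt).mul_right q
    have h3 := (Nat.dvd_add_right h2).1 hd
    have := Nat.le_of_dvd (by positivity) h3
    rw [pow_succ] at this
    have : 0 < 2^r := by positivity
    omega
  · rintro rfl
    rw [show 2^r * q + 2^r = 2^r * (q+1) by ring, pow_succ]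
    apply Nat.mul_dvd_mul_left
    omega

lemma qp_succ (s i : ℕ) : qp s (i+1) = qp s i + (qe s 0 + qe s (padicValNat 2 (i+1) + 1)) := by
  funext c
  obtain ⟨c, hc⟩ := c
  cases c with
  | zero =>
    simp only [qp, qe, Pi.add_apply, if_true, ofNat_add]
    simp
  | succ r =>
    have := val_iff i r
    simp only [qp, qe, Pi.add_apply]
    simp only [Nat.add_eq_zero_iff, one_ne_zero, and_false, if_false, Nat.add_sub_cancel, zero_add,
      Nat.add_right_cancel_iff]
    rw [show i + 1 + 2^r = i + 2^r + 1 by ring, Nat.succ_div, ofNat_add]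
    by_cases h : r = padicValNat 2 (i+1)
    · rw [if_pos h, if_pos (this.2 h)]; rfl
    · rw [if_neg h, if_neg (fun h' => h (this.1 h'))]; rfl

lemma qp_zero (s : ℕ) : qp s 0 = 0 := by
  funext c
  obtain ⟨c, hc⟩ := c
  cases c with
  | zero => simp [qp]
  | succ r =>
    have : 2^r / 2^(r+1) = 0 := Nat.div_eq_of_lt (Nat.pow_lt_pow_right (by norm_num) (by omega))
    simp [qp, this]

lemma qp_last (s : ℕ) : qp s (2^s - 1) + (qe s 0 + qe s s) = 0 := by
  rw [qa_add_eq_zero]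
  funext c
  obtain ⟨c, hc⟩ := c
  cases c with
  | zero =>
    cases s with
    | zero => simp [qp, qe]
    | succ s =>
      simp only [qp, qe, Pi.add_apply, if_true]
      have h1 : Fin.ofNat 2 (2^(s+1) - 1) = Fin.ofNat 2 1 := by
        rw [ofNat_eq]
        have : 0 < 2^s := by positivity
        rw [pow_succ]; omega
      rw [h1]; simp
  | succ r =>
    simp only [qp, qe, Pi.add_apply, Nat.add_eq_zero_iff, one_ne_zero, and_false, if_false,
      Nat.add_sub_cancel, zero_add]
    have hr : 0 < 2^r := by positivity
    by_cases h : r + 1 = s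
    · subst h
      have : (2^(r+1) - 1 + 2^r) / 2^(r+1) = 1 := by
        rw [Nat.div_eq_iff (by positivity)]
        rw [pow_succ]; omega
      rw [this]; simp
    · obtain ⟨t, rfl⟩ : ∃ t, s = r + 2 + t := ⟨s - (r+2), by omega⟩
      have : (2^(r+2+t) - 1 + 2^r) / 2^(r+1) = 2 * 2^t := by
        rw [Nat.div_eq_iff (by positivity)]
        have h2 : 2^(r+2+t) = 2 * 2^t * 2^(r+1) := by ring
        have h4 : 0 < 2 * 2^t * 2^(r+1) := by positivity
        rw [h2]
        have h3 : 2^(r+1) = 2 * 2^r := by ring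
        generalize 2 * 2^t * 2^(r+1) = z at *
        omega
      rw [this, if_neg h]
      rw [show (0 : Fin 2) = Fin.ofNat 2 0 from rfl, ofNat_eq]; omega

lemma qp_inj (s i j : ℕ) (hi : i < 2^s) (hj : j < 2^s)
    (h : ∀ c : Fin s, qp s i c.succ = qp s j c.succ) : i = j := by
  have key : ∀ d, d ≤ s → i / 2^(s-d) = j / 2^(s-d) := by
    intro d
    induction d with
    | zero => intro _; simp [Nat.div_eq_of_lt hi, Nat.div_eq_of_lt hj]
    | succ d ih =>
      intro hd
      have ih := ih (by omega)
      have hh := h ⟨s - (d+1), by omega⟩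
      obtain ⟨r, hr⟩ : ∃ r, r = s - (d+1) := ⟨_, rfl⟩
      rw [show s - d = r + 1 by omega] at ih
      simp only [← hr] at hh ⊢
      simp only [qp, Fin.val_succ, Nat.add_eq_zero_iff, one_ne_zero, and_false, if_false,
        Nat.add_sub_cancel, ofNat_eq] at hh
      have e : ∀ a, (a + 2^r) / 2^(r+1) = (a / 2^r + 1) / 2 := by
        intro a
        rw [pow_succ, ← Nat.div_div_eq_div_mul, Nat.add_div_right _ (by positivity)]
      rw [pow_succ, ← Nat.div_div_eq_div_mul, ← Nat.div_div_eq_div_mul] at ih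
      rw [e, e] at hh
      omega
  simpa using key s le_rfl

lemma qp_surj (s : ℕ) (x : QA s) : ∃ i, i < 2^s ∧ ∀ c : Fin s, qp s i c.succ = x c.succ := by
  let f : Fin (2^s) → (Fin s → Fin 2) := fun i c => qp s i c.succ
  have hf : Function.Injective f := fun i j h =>
    Fin.ext (qp_inj s i j i.2 j.2 (fun c => congrFun h c))
  have hb : Function.Bijective f :=
    (Fintype.bijective_iff_injective_and_card f).2 ⟨hf, by simp⟩
  obtain ⟨i, hi⟩ := hb.2 (fun c => x c.succ)
  exact ⟨i, i.2, fun c => congrFun hi c⟩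

noncomputable def FF {s N : ℕ} (C : Matrix (Fin N) (Fin N) ℂ) (x : QA s) :
    Matrix (Fin N) (Fin N) ℂ := uu C x * (uu C (x + qe s 0))ᴴ

lemma prod_single {M : Type*} [Monoid M] (D : M) (i0 n : ℕ) (f : ℕ → M)
    (h0 : f i0 = D) (h : ∀ i, i < n → i ≠ i0 → f i = 1) :
    ((List.range n).map f).prod = if i0 < n then D else 1 := by
  induction n with
  | zero => simp
  | succ n ih =>
    rw [List.range_succ, List.map_append, List.prod_append, ih (fun i hi => h i (by omega))]
    simp only [List.map_cons, List.map_nil, List.prod_cons, List.prod_nil, mul_one]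
    by_cases hn : n = i0
    · subst hn; simp [h0]
    · rw [h n (by omega) hn, mul_one]
      congr 1
      apply propext; omega

lemma qe0_ne (s : ℕ) : qe s 0 ≠ 0 := by
  intro h
  have := congrFun h 0
  simp [qe] at this

lemma FF_eq {s N : ℕ} (C : Matrix (Fin N) (Fin N) ℂ) (x : QA s) :
    FF C x = if x = 0 then C else if x = qe s 0 then Cᴴ else 1 := by
  unfold FF uu
  simp only [qa_add_eq_zero]
  by_cases h : x = 0
  · subst h
    simp [qe0_ne s]
  · by_cases h' : x = qe s 0
    · simp [h', qe0_ne s]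
    · have : ¬ qe s 0 = x := fun h => h' h.symm
      simp [h, h', this]

noncomputable def PP {s N : ℕ} (C : Matrix (Fin N) (Fin N) ℂ) (n : ℕ) (x : QA s) :
    Matrix (Fin N) (Fin N) ℂ := ((List.range n).map (fun i => FF C (x + qp s i))).prod

lemma PP_of {s N : ℕ} (C : Matrix (Fin N) (Fin N) ℂ) (x : QA s) (i0 : ℕ) (hi0 : i0 < 2^s)
    (h : ∀ c : Fin s, qp s i0 c.succ = x c.succ) :
    PP C (2^s) x = FF C (x + qp s i0) := by
  unfold PP
  rw [prod_single (FF C (x + qp s i0)) i0 (2^s) _ rfl, if_pos hi0]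
  intro i hi hne
  have h2 : ¬ ∀ c : Fin s, (x + qp s i) c.succ = 0 := by
    intro hc
    apply hne
    apply qp_inj s i i0 hi hi0
    intro c
    rw [h c]
    have := hc c
    have hd : ∀ a b : Fin 2, a + b = 0 → b = a := by decide
    exact hd _ _ this
  rw [FF_eq, if_neg, if_neg]
  · intro h3; apply h2; intro c; rw [h3]; simp [qe]
  · intro h3; apply h2; intro c; rw [h3]; rfl

lemma PP_pair {s N : ℕ} (C : Matrix (Fin N) (Fin N) ℂ) (x : QA s) :
    (PP C (2^s) x).trace + (PP C (2^s) (x + qe s 0)).trace = 2 * (C.trace.re : ℂ) := by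
  obtain ⟨i, hi, h⟩ := qp_surj s x
  have h' : ∀ c : Fin s, qp s i c.succ = (x + qe s 0) c.succ := by
    intro c; rw [h c]; simp [qe]
  rw [PP_of C x i hi h, PP_of C _ i hi h', add_right_comm]
  have hr : C.trace + Cᴴ.trace = 2 * (C.trace.re : ℂ) := by
    rw [Matrix.trace_conjTranspose, Complex.star_def, Complex.add_conj]; push_cast; ring
  have h3 : x + qp s i = 0 ∨ x + qp s i = qe s 0 := by
    have hd : ∀ a : Fin 2, a = 0 ∨ a = 1 := by decide
    have hs : ∀ c : Fin s, (x + qp s i) c.succ = 0 := by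
      intro c
      have := congrFun (qa_add_self x) c.succ
      rw [Pi.add_apply, h c]; exact this
    rcases hd ((x + qp s i) 0) with h0 | h0
    · left; funext c; refine Fin.cases h0 hs c
    · right; funext c
      refine Fin.cases ?_ ?_ c
      · rw [h0]; simp [qe]
      · intro c; rw [hs c]; simp [qe]
  rcases h3 with h3 | h3
  · rw [h3, zero_add, FF_eq, FF_eq, if_pos rfl, if_neg (qe0_ne s), if_pos rfl, hr]
  · rw [h3, qa_add_self, FF_eq, FF_eq, if_pos rfl, if_neg (qe0_ne s), if_pos rfl, add_comm, hr]

lemma step_MM {s N : ℕ} (C : Matrix (Fin N) (Fin N) ℂ) (r : ℕ) :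
    (MM 0 (uu C) * MM (qe s 0) (fun _ => 1) * (MM 0 (uu C))ᴴ * MM (qe s r) (fun _ => 1)
      : Matrix (QA s × Fin N) (QA s × Fin N) ℂ) = MM (qe s 0 + qe s r) (FF C) := by
  rw [MM_zero_conj, MM_mul, MM_mul, MM_mul]
  simp only [zero_add, add_zero, mul_one]
  rfl

lemma prod_MM {s N : ℕ} (C : Matrix (Fin N) (Fin N) ℂ)
    (G : ℕ → Matrix (QA s × Fin N) (QA s × Fin N) ℂ) (n : ℕ)
    (hG : ∀ i, i < n → G i = MM (qe s 0 + qe s (padicValNat 2 (i+1) + 1)) (FF C)) :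
    ((List.range n).map G).prod = MM (qp s n) (PP C n) := by
  induction n with
  | zero => simp only [List.range_zero, List.map_nil, List.prod_nil, MM_one, qp_zero]; rfl
  | succ n ih =>
    rw [List.range_succ, List.map_append, List.prod_append, ih (fun i hi => hG i (by omega))]
    simp only [List.map_cons, List.map_nil, List.prod_cons, List.prod_nil, mul_one]
    rw [hG n (by omega), MM_mul, ← qp_succ]
    congr 1
    funext x
    simp [PP, List.range_succ]

/-- Lemma 1 reduction identity: for `k = 2^s`, `n = m + s + 1`,
`U = (|0⟩⟨0|)^{⊗(s+1)} ⊗ C + (I − (|0⟩⟨0|)^{⊗(s+1)}) ⊗ I`,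
`W_j = X^{(1)}`, `V_j = X^{(ν₂(j)+2)}` for `1 ≤ j ≤ k−1`, `V_k = X^{(s+1)}`
(qubits 1-based, here 0-based), the `2k`-point OTOC
`(1/2^n) Tr[(U W_1 U† V_1) ⋯ (U W_k U† V_k)]` equals `Re(Tr C)/2^m`. -/
theorem otoc_2k_gray_code_reduction (m s : ℕ) (hm : 1 ≤ m)
    (C : Matrix (Fin (2^m)) (Fin (2^m)) ℂ)
    (hC : C ∈ Matrix.unitaryGroup (Fin (2^m)) ℂ) :
    let k := 2^s
    let U : Matrix ((Fin (s+1) → Fin 2) × Fin (2^m)) ((Fin (s+1) → Fin 2) × Fin (2^m)) ℂ :=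
      allZeroProj (s+1) ⊗ₖ C +
        ((1 : Matrix (Fin (s+1) → Fin 2) (Fin (s+1) → Fin 2) ℂ) - allZeroProj (s+1)) ⊗ₖ
          (1 : Matrix (Fin (2^m)) (Fin (2^m)) ℂ)
    let W : Matrix ((Fin (s+1) → Fin 2) × Fin (2^m)) ((Fin (s+1) → Fin 2) × Fin (2^m)) ℂ :=
      pauliXOn (s+1) 0 ⊗ₖ (1 : Matrix (Fin (2^m)) (Fin (2^m)) ℂ)
    let V : ℕ → Matrix ((Fin (s+1) → Fin 2) × Fin (2^m)) ((Fin (s+1) → Fin 2) × Fin (2^m)) ℂ :=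
      fun j =>
        (if j = k then pauliXOn (s+1) s else pauliXOn (s+1) (padicValNat 2 j + 1)) ⊗ₖ
          (1 : Matrix (Fin (2^m)) (Fin (2^m)) ℂ)
    (1 / (2:ℂ)^(m + s + 1)) *
        Matrix.trace (((List.range k).map (fun i => U * W * Uᴴ * V (i + 1))).prod)
      = ((Matrix.trace C).re : ℂ) / (2:ℂ)^m := by
  intro k U W V
  have hk : 0 < 2^s := by positivity
  have hstep : ∀ i r, V (i+1) = MM (qe s r) (fun _ => 1) →
      U * W * Uᴴ * V (i+1) = MM (qe s 0 + qe s r) (FF C) := by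
    intro i r h
    rw [h, ← step_MM C r]
    simp only [U, W, U_MM, pauli_MM]
  have hprod : ((List.range k).map (fun i => U * W * Uᴴ * V (i + 1))).prod
      = MM 0 (PP C (2^s)) := by
    obtain ⟨n, hn⟩ : ∃ n, 2^s = n + 1 := ⟨2^s - 1, by omega⟩
    have hkn : k = n + 1 := hn
    rw [hkn, List.range_succ, List.map_append, List.prod_append,
      prod_MM C (fun i => U * W * Uᴴ * V (i + 1)) n]
    · simp only [List.map_cons, List.map_nil, List.prod_cons, List.prod_nil, mul_one]
      rw [hstep n s, MM_mul]
      · have h1 := qp_last s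
        rw [show 2^s - 1 = n by omega] at h1
        rw [h1, hn]
        congr 1
        funext x
        simp [PP, List.range_succ]
      · simp only [V]
        rw [if_pos hkn.symm, pauli_MM]
    · intro i hi
      apply hstep
      simp only [V]
      rw [if_neg (by omega), pauli_MM]
  rw [hprod, MM_trace]
  have h2 : 2 * ∑ x : QA s, (PP C (2^s) x).trace = 2^(s+1) * (2 * (C.trace.re : ℂ)) := by
    have h3 : ∑ x : QA s, (PP C (2^s) (x + qe s 0)).trace = ∑ x : QA s, (PP C (2^s) x).trace :=
      Fintype.sum_equiv (Equiv.addRight (qe s 0)) _ _ (fun x => rfl)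
    rw [two_mul]
    nth_rewrite 2 [← h3]
    rw [← Finset.sum_add_distrib, Finset.sum_congr rfl (fun x _ => PP_pair C x)]
    simp
  have h4 : ∑ x : QA s, (PP C (2^s) x).trace = 2^(s+1) * (C.trace.re : ℂ) := by
    linear_combination h2 / 2
  rw [h4, show m + s + 1 = m + (s+1) by ring, pow_add]
  field_simp
end

section
/- Let m ≥ 1 and let C be a unitary 2^m × 2^m complex matrix. Define the 2^{m+1} × 2^{m+1} unitary U = |0⟩⟨0| ⊗ C + |1⟩⟨1| ⊗ I_{2^m}, and let W = V = σx ⊗ I_{2^m}. Then (1/2^{m+1}) · Tr[U W U† V] = Re(Tr C)/2^m. -/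
open Matrix
open scoped Kronecker

/-- Pauli X matrix. -/
noncomputable def sigmaX : Matrix (Fin 2) (Fin 2) ℂ := !![0, 1; 1, 0]

/-- The projector |0⟩⟨0|. -/
noncomputable def ket0bra0 : Matrix (Fin 2) (Fin 2) ℂ := !![1, 0; 0, 0]

/-- The projector |1⟩⟨1|. -/
noncomputable def ket1bra1 : Matrix (Fin 2) (Fin 2) ℂ := !![0, 0; 0, 1]

/-- Appendix Example 1: the 2-point OTOC reduction identity.
For `U = |0⟩⟨0| ⊗ C + |1⟩⟨1| ⊗ I` and `W = V = σx ⊗ I`,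
`(1/2^{m+1}) Tr[U W U† V] = Re(Tr C)/2^m`. -/
theorem two_point_otoc_reduction (m : ℕ) (hm : 1 ≤ m)
    (C : Matrix (Fin (2^m)) (Fin (2^m)) ℂ)
    (hC : C ∈ Matrix.unitaryGroup (Fin (2^m)) ℂ) :
    let U : Matrix (Fin 2 × Fin (2^m)) (Fin 2 × Fin (2^m)) ℂ :=
      ket0bra0 ⊗ₖ C + ket1bra1 ⊗ₖ (1 : Matrix (Fin (2^m)) (Fin (2^m)) ℂ)
    let W : Matrix (Fin 2 × Fin (2^m)) (Fin 2 × Fin (2^m)) ℂ :=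
      sigmaX ⊗ₖ (1 : Matrix (Fin (2^m)) (Fin (2^m)) ℂ)
    let V : Matrix (Fin 2 × Fin (2^m)) (Fin 2 × Fin (2^m)) ℂ :=
      sigmaX ⊗ₖ (1 : Matrix (Fin (2^m)) (Fin (2^m)) ℂ)
    (1 / (2:ℂ)^(m+1)) * Matrix.trace (U * W * Uᴴ * V)
      = ((Matrix.trace C).re : ℂ) / (2:ℂ)^m := by
  intro U W V
  have hT : Matrix.trace (U * W * Uᴴ * V) = Matrix.trace C + star (Matrix.trace C) := by
    have h0 : ket0bra0ᴴ = ket0bra0 := by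
      ext i j; fin_cases i <;> fin_cases j <;> simp [ket0bra0]
    have h1 : ket1bra1ᴴ = ket1bra1 := by
      ext i j; fin_cases i <;> fin_cases j <;> simp [ket1bra1]
    have hU : Uᴴ = ket0bra0 ⊗ₖ Cᴴ + ket1bra1 ⊗ₖ (1 : Matrix (Fin (2^m)) (Fin (2^m)) ℂ) := by
      simp only [U, Matrix.conjTranspose_add, Matrix.conjTranspose_kronecker,
        Matrix.conjTranspose_one, h0, h1]
    rw [hU]
    simp only [U, W, V, Matrix.add_mul, Matrix.mul_add, ← Matrix.mul_kronecker_mul,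
      Matrix.trace_add, Matrix.trace_kronecker, Matrix.mul_one, Matrix.one_mul,
      Matrix.trace_conjTranspose]
    simp [ket0bra0, ket1bra1, sigmaX, Matrix.trace_fin_two]
    try ring
  rw [hT]
  have h2 : Matrix.trace C + star (Matrix.trace C) = 2 * ((Matrix.trace C).re : ℂ) := by
    have := Complex.add_conj (Matrix.trace C)
    simpa using this
  rw [h2, pow_succ]
  field_simp
end

section
/- Let m ≥ 1 and let C be a unitary 2^m × 2^m complex matrix. Define the 2^{m+2} × 2^{m+2} unitary U = (|0⟩⟨0| ⊗ |0⟩⟨0|) ⊗ C + (I_4 − |0⟩⟨0| ⊗ |0⟩⟨0|) ⊗ I_{2^m}. Let W_1 = W_2 = σx ⊗ I_2 ⊗ I_{2^m} (Pauli-X on ancilla qubit 1) and V_1 = V_2 = I_2 ⊗ σx ⊗ I_{2^m} (Pauli-X on ancilla qubit 2). Then (1/2^{m+2}) · Tr[(U W_1 U† V_1)(U W_2 U† V_2)] = Re(Tr C)/2^m. -/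
open Matrix
open scoped Kronecker

/-- The 4-point OTOC reduction identity (k = 2 case of the Gray-code gadget of Lemma 1):
for `U = |00⟩⟨00| ⊗ C + (I₄ − |00⟩⟨00|) ⊗ I`, `W₁ = W₂ = σx ⊗ I₂ ⊗ I`,
`V₁ = V₂ = I₂ ⊗ σx ⊗ I`, we have
`(1/2^{m+2}) Tr[(U W₁ U† V₁)(U W₂ U† V₂)] = Re(Tr C)/2^m`. -/
theorem four_point_otoc_reduction (m : ℕ) (hm : 1 ≤ m)
    (C : Matrix (Fin (2^m)) (Fin (2^m)) ℂ)
    (hC : C ∈ Matrix.unitaryGroup (Fin (2^m)) ℂ) :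
    let U : Matrix ((Fin 2 × Fin 2) × Fin (2^m)) ((Fin 2 × Fin 2) × Fin (2^m)) ℂ :=
      (ket0bra0 ⊗ₖ ket0bra0) ⊗ₖ C +
        ((1 : Matrix (Fin 2 × Fin 2) (Fin 2 × Fin 2) ℂ) - ket0bra0 ⊗ₖ ket0bra0) ⊗ₖ
          (1 : Matrix (Fin (2^m)) (Fin (2^m)) ℂ)
    let W : Matrix ((Fin 2 × Fin 2) × Fin (2^m)) ((Fin 2 × Fin 2) × Fin (2^m)) ℂ :=
      (sigmaX ⊗ₖ (1 : Matrix (Fin 2) (Fin 2) ℂ)) ⊗ₖ (1 : Matrix (Fin (2^m)) (Fin (2^m)) ℂ)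
    let V : Matrix ((Fin 2 × Fin 2) × Fin (2^m)) ((Fin 2 × Fin 2) × Fin (2^m)) ℂ :=
      ((1 : Matrix (Fin 2) (Fin 2) ℂ) ⊗ₖ sigmaX) ⊗ₖ (1 : Matrix (Fin (2^m)) (Fin (2^m)) ℂ)
    (1 / (2:ℂ)^(m+2)) * Matrix.trace ((U * W * Uᴴ * V) * (U * W * Uᴴ * V))
      = ((Matrix.trace C).re : ℂ) / (2:ℂ)^m := by
  intro U W V
  let P : Matrix (Fin 2 × Fin 2) (Fin 2 × Fin 2) ℂ := ket0bra0 ⊗ₖ ket0bra0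
  let X : Matrix (Fin 2 × Fin 2) (Fin 2 × Fin 2) ℂ := sigmaX ⊗ₖ 1
  let Y : Matrix (Fin 2 × Fin 2) (Fin 2 × Fin 2) ℂ := 1 ⊗ₖ sigmaX
  let a := Matrix.single ((0 : Fin 2), (0 : Fin 2)) ((1 : Fin 2), (1 : Fin 2)) (1 : ℂ)
  let b := Matrix.single ((1 : Fin 2), (0 : Fin 2)) ((0 : Fin 2), (1 : Fin 2)) (1 : ℂ)
  let c := Matrix.single ((1 : Fin 2), (1 : Fin 2)) ((0 : Fin 2), (0 : Fin 2)) (1 : ℂ)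
    + Matrix.single ((0 : Fin 2), (1 : Fin 2)) ((1 : Fin 2), (0 : Fin 2)) (1 : ℂ)
  have hP : Pᴴ = P := by
    ext ⟨i, j⟩ ⟨k, l⟩
    fin_cases i <;> fin_cases j <;> fin_cases k <;> fin_cases l <;> simp [P, ket0bra0]
  have h0 : P * X * P * Y = 0 := by
    ext ⟨i, j⟩ ⟨k, l⟩
    fin_cases i <;> fin_cases j <;> fin_cases k <;> fin_cases l <;>
      simp [P, X, Y, ← Matrix.mul_kronecker_mul, ket0bra0, sigmaX]
  have ha' : P * X * Y = a := by
    ext ⟨i, j⟩ ⟨k, l⟩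
    fin_cases i <;> fin_cases j <;> fin_cases k <;> fin_cases l <;>
      simp [P, X, Y, a, ← Matrix.mul_kronecker_mul, ket0bra0, sigmaX, Matrix.single]
  have hb' : X * P * Y = b := by
    ext ⟨i, j⟩ ⟨k, l⟩
    fin_cases i <;> fin_cases j <;> fin_cases k <;> fin_cases l <;>
      simp [P, X, Y, b, ← Matrix.mul_kronecker_mul, ket0bra0, sigmaX, Matrix.single]
  have hc' : X * Y = a + b + c := by
    ext ⟨i, j⟩ ⟨k, l⟩
    fin_cases i <;> fin_cases j <;> fin_cases k <;> fin_cases l <;>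
      simp [X, Y, a, b, c, ← Matrix.mul_kronecker_mul, sigmaX, Matrix.single]
  have ha : P * X * (1 - P) * Y = a := by
    simp only [mul_sub, sub_mul, mul_one, h0, ha', sub_zero]
  have hb : (1 - P) * X * P * Y = b := by
    simp only [sub_mul, one_mul, h0, hb', sub_zero]
  have hc : (1 - P) * X * (1 - P) * Y = c := by
    simp only [mul_sub, sub_mul, mul_one, one_mul, h0, ha', hb', hc']
    abel
  have hU : U = P ⊗ₖ C + (1 - P) ⊗ₖ 1 := rfl
  have hW : W = X ⊗ₖ 1 := rfl
  have hV : V = Y ⊗ₖ 1 := rfl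
  have hA : U * W * Uᴴ * V = a ⊗ₖ C + b ⊗ₖ Cᴴ + c ⊗ₖ 1 := by
    rw [hU, hW, hV]
    simp only [Matrix.conjTranspose_add, Matrix.conjTranspose_kronecker,
      Matrix.conjTranspose_sub, Matrix.conjTranspose_one, hP, add_mul, mul_add,
      ← Matrix.mul_kronecker_mul, mul_one, one_mul, h0, ha, hb, hc, Matrix.zero_kronecker]
    abel
  have tr : Matrix.trace ((U * W * Uᴴ * V) * (U * W * Uᴴ * V))
      = 2 * Matrix.trace C + 2 * Matrix.trace Cᴴ := by
    rw [hA]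
    simp only [add_mul, mul_add, ← Matrix.mul_kronecker_mul, Matrix.trace_add,
      Matrix.trace_kronecker, mul_one, one_mul]
    simp [a, b, c, mul_add, add_mul]
    ring
  rw [tr, Matrix.trace_conjTranspose]
  have h2 : (2 : ℂ) * Matrix.trace C + 2 * star (Matrix.trace C)
      = 4 * ((Matrix.trace C).re : ℂ) := by
    have := Complex.add_conj (Matrix.trace C)
    rw [← mul_add, Complex.star_def, this]
    push_cast
    ring
  rw [h2, pow_add]
  field_simp
  norm_num
end

section
/- Let m ≥ 1 and let C be a unitary 2^m × 2^m complex matrix. Define the 2^{m+3} × 2^{m+3} unitary U = (|0⟩⟨0|)^{⊗3} ⊗ C + (I_8 − (|0⟩⟨0|)^{⊗3}) ⊗ I_{2^m}. For r ∈ {1,2,3} let X^{(r)} denote Pauli-X on ancilla qubit r, i.e. X^{(r)} = I_{2^{r−1}} ⊗ σx ⊗ I_{2^{3−r}} ⊗ I_{2^m}. Set W_1 = X^{(1)}, V_1 = X^{(2)}, W_2 = X^{(3)}, V_2 = X^{(1)}, W_3 = X^{(2)}, V_3 = X^{(3)}. Then (1/2^{m+3}) · Tr[(U W_1 U† V_1)(U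 W_2 U† V_2)(U W_3 U† V_3)] = 1/4 + (3/4) · Re(Tr C)/2^m. -/
open Matrix
open scoped Kronecker

abbrev AncIdx := Fin 2 × (Fin 2 × Fin 2)

/-- Block matrix sending block `a + e` to block `a` via `f a`. -/
def shiftBlk {n : ℕ} (e : AncIdx) (f : AncIdx → Matrix (Fin n) (Fin n) ℂ) :
    Matrix (AncIdx × Fin n) (AncIdx × Fin n) ℂ :=
  Matrix.of fun p q => if q.1 = p.1 + e then f p.1 p.2 q.2 else 0

theorem shiftBlk_mul {n : ℕ} (e e' : AncIdx) (f g : AncIdx → Matrix (Fin n) (Fin n) ℂ) :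
    shiftBlk e f * shiftBlk e' g = shiftBlk (e + e') (fun a => f a * g (a + e)) := by
  ext ⟨a, i⟩ ⟨b, j⟩
  simp only [shiftBlk, Matrix.mul_apply, Matrix.of_apply]
  rw [Fintype.sum_prod_type, Finset.sum_eq_single (a + e)]
  · by_cases h : b = a + e + e'
    · simp [h, add_assoc]
    · have h' : ¬ b = a + (e + e') := by rwa [← add_assoc]
      simp [h, h']
  · intro c _ hc
    simp [hc]
  · simp

theorem trace_shiftBlk {n : ℕ} (f : AncIdx → Matrix (Fin n) (Fin n) ℂ) :
    (shiftBlk 0 f).trace = ∑ a, (f a).trace := by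
  simp [Matrix.trace, shiftBlk, Fintype.sum_prod_type]

theorem shiftBlk_conjTranspose {n : ℕ} (f : AncIdx → Matrix (Fin n) (Fin n) ℂ) :
    (shiftBlk 0 f)ᴴ = shiftBlk 0 (fun a => (f a)ᴴ) := by
  ext ⟨a, i⟩ ⟨b, j⟩
  by_cases h : a = b
  · subst h; simp [shiftBlk, Matrix.conjTranspose_apply]
  · have h' : ¬ b = a := fun k => h k.symm
    simp [shiftBlk, Matrix.conjTranspose_apply, h, h']

theorem shiftBlk_key (m : ℕ) (C : Matrix (Fin (2^m)) (Fin (2^m)) ℂ) :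
    Matrix.trace (
      (shiftBlk 0 (fun a => if a = 0 then C else 1) * shiftBlk (1, 0, 0) (fun _ => 1)
        * shiftBlk 0 (fun a => (if a = 0 then C else 1)ᴴ) * shiftBlk (0, 1, 0) (fun _ => 1))
      * (shiftBlk 0 (fun a => if a = 0 then C else 1) * shiftBlk (0, 0, 1) (fun _ => 1)
        * shiftBlk 0 (fun a => (if a = 0 then C else 1)ᴴ) * shiftBlk (1, 0, 0) (fun _ => 1))
      * (shiftBlk 0 (fun a => if a = 0 then C else 1) * shiftBlk (0, 1, 0) (fun _ => 1)
        * shiftBlk 0 (fun a => (if a = 0 then C else 1)ᴴ) * shiftBlk (0, 0, 1) (fun _ => 1)))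
      = 2 * (2:ℂ)^m + 3 * (C.trace + star C.trace) := by
  simp only [shiftBlk_mul]
  have e0 : ∀ (e : AncIdx) (f : AncIdx → Matrix (Fin (2^m)) (Fin (2^m)) ℂ), e = 0 →
      (shiftBlk e f).trace = ∑ a, (f a).trace := by
    rintro e f rfl; exact trace_shiftBlk f
  rw [e0 _ _ (by decide)]
  have h2 : (starRingEnd ℂ) 2 = 2 := Complex.conj_ofNat 2
  simp [Fintype.sum_prod_type, Fin.sum_univ_two, Matrix.trace_conjTranspose, h2]
  ring

/-- Appendix Example 3 (6-point OTOC, k = 3, affine reduction identity):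
for `U = (|0⟩⟨0|)^{⊗3} ⊗ C + (I₈ − (|0⟩⟨0|)^{⊗3}) ⊗ I` and
`W₁ = X^{(1)}, V₁ = X^{(2)}, W₂ = X^{(3)}, V₂ = X^{(1)}, W₃ = X^{(2)}, V₃ = X^{(3)}`,
`(1/2^{m+3}) Tr[(U W₁ U† V₁)(U W₂ U† V₂)(U W₃ U† V₃)] = 1/4 + (3/4)·Re(Tr C)/2^m`. -/
theorem six_point_otoc_reduction (m : ℕ) (hm : 1 ≤ m)
    (C : Matrix (Fin (2^m)) (Fin (2^m)) ℂ)
    (hC : C ∈ Matrix.unitaryGroup (Fin (2^m)) ℂ) :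
    let A := Fin 2 × (Fin 2 × Fin 2)
    let I2 : Matrix (Fin 2) (Fin 2) ℂ := 1
    let Im : Matrix (Fin (2^m)) (Fin (2^m)) ℂ := 1
    let P000 : Matrix A A ℂ := ket0bra0 ⊗ₖ (ket0bra0 ⊗ₖ ket0bra0)
    let U : Matrix (A × Fin (2^m)) (A × Fin (2^m)) ℂ :=
      P000 ⊗ₖ C + ((1 : Matrix A A ℂ) - P000) ⊗ₖ Im
    let X1 : Matrix (A × Fin (2^m)) (A × Fin (2^m)) ℂ := (sigmaX ⊗ₖ (I2 ⊗ₖ I2)) ⊗ₖ Im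
    let X2 : Matrix (A × Fin (2^m)) (A × Fin (2^m)) ℂ := (I2 ⊗ₖ (sigmaX ⊗ₖ I2)) ⊗ₖ Im
    let X3 : Matrix (A × Fin (2^m)) (A × Fin (2^m)) ℂ := (I2 ⊗ₖ (I2 ⊗ₖ sigmaX)) ⊗ₖ Im
    (1 / (2:ℂ)^(m+3)) *
        Matrix.trace ((U * X1 * Uᴴ * X2) * (U * X3 * Uᴴ * X1) * (U * X2 * Uᴴ * X3))
      = 1/4 + (3/4) * (((Matrix.trace C).re : ℂ) / (2:ℂ)^m) := by
  intro A I2 Im P000 U X1 X2 X3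
  have hU : U = shiftBlk 0 (fun a => if a = 0 then C else 1) := by
    ext ⟨⟨a, b, c⟩, i⟩ ⟨⟨a', b', c'⟩, j⟩
    fin_cases a <;> fin_cases b <;> fin_cases c <;> fin_cases a' <;> fin_cases b' <;>
      fin_cases c' <;>
      simp [U, P000, Im, shiftBlk, ket0bra0, Matrix.one_apply]
  have h1 : X1 = shiftBlk (1, 0, 0) (fun _ => 1) := by
    ext ⟨⟨a, b, c⟩, i⟩ ⟨⟨a', b', c'⟩, j⟩
    fin_cases a <;> fin_cases b <;> fin_cases c <;> fin_cases a' <;> fin_cases b' <;>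
      fin_cases c' <;>
      simp [X1, I2, Im, shiftBlk, sigmaX, Matrix.one_apply]
  have h2 : X2 = shiftBlk (0, 1, 0) (fun _ => 1) := by
    ext ⟨⟨a, b, c⟩, i⟩ ⟨⟨a', b', c'⟩, j⟩
    fin_cases a <;> fin_cases b <;> fin_cases c <;> fin_cases a' <;> fin_cases b' <;>
      fin_cases c' <;>
      simp [X2, I2, Im, shiftBlk, sigmaX, Matrix.one_apply]
  have h3 : X3 = shiftBlk (0, 0, 1) (fun _ => 1) := by
    ext ⟨⟨a, b, c⟩, i⟩ ⟨⟨a', b', c'⟩, j⟩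
    fin_cases a <;> fin_cases b <;> fin_cases c <;> fin_cases a' <;> fin_cases b' <;>
      fin_cases c' <;>
      simp [X3, I2, Im, shiftBlk, sigmaX, Matrix.one_apply]
  have key : Matrix.trace ((U * X1 * Uᴴ * X2) * (U * X3 * Uᴴ * X1) * (U * X2 * Uᴴ * X3))
      = 2 * (2:ℂ)^m + 3 * (C.trace + star C.trace) := by
    rw [hU, h1, h2, h3, shiftBlk_conjTranspose]
    exact shiftBlk_key m C
  have hre : C.trace + star C.trace = 2 * ((C.trace.re : ℝ) : ℂ) := by
    have := Complex.add_conj C.trace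
    simpa using this
  rw [key, hre, pow_add]
  have : (2:ℂ)^m ≠ 0 := pow_ne_zero _ two_ne_zero
  field_simp
  ring
end

section
/- Let m ≥ 1 and let C be a unitary 2^m × 2^m complex matrix. Define the 2^{m+3} × 2^{m+3} unitary U = (|0⟩⟨0|)^{⊗3} ⊗ C + (I_8 − (|0⟩⟨0|)^{⊗3}) ⊗ I_{2^m}. For r ∈ {1,2,3} let X^{(r)} = I_{2^{r−1}} ⊗ σx ⊗ I_{2^{3−r}} ⊗ I_{2^m}. Set W_1 = W_2 = W_3 = W_4 = X^{(1)}, V_1 = X^{(2)}, V_2 = X^{(3)}, V_3 = X^{(2)}, V_4 = X^{(3)}. Then (1/2^{m+3}) · Tr[(U W_1 U† V_1)(U W_2 U† V_2)(U W_3 U† V_3)(U W_4 U† V_4)] = Re(Tr C)/2^m. -/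
open Matrix
open scoped Kronecker

/-- Block-monomial matrix: row block `i` has the block `f i` in column block `s i`. -/
noncomputable def monoB {A n : Type} [DecidableEq A] (s : A → A) (f : A → Matrix n n ℂ) :
    Matrix (A × n) (A × n) ℂ :=
  Matrix.of fun p q => if q.1 = s p.1 then f p.1 p.2 q.2 else 0

lemma monoB_mul {A n : Type} [DecidableEq A] [Fintype A] [Fintype n] (s t : A → A)
    (f g : A → Matrix n n ℂ) :
    monoB s f * monoB t g = monoB (fun i => t (s i)) (fun i => f i * g (s i)) := by
  ext ⟨i, x⟩ ⟨j, y⟩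
  simp only [monoB, Matrix.mul_apply, Matrix.of_apply, Fintype.sum_prod_type]
  rw [Finset.sum_eq_single (s i)]
  · by_cases h : j = t (s i) <;> simp [h]
  · intro b _ hb
    simp [hb]
  · simp

lemma monoB_trace {A n : Type} [DecidableEq A] [Fintype A] [Fintype n] (s : A → A)
    (f : A → Matrix n n ℂ) :
    Matrix.trace (monoB s f) = ∑ i, if i = s i then Matrix.trace (f i) else 0 := by
  simp only [monoB, Matrix.trace, Matrix.diag, Matrix.of_apply, Fintype.sum_prod_type]
  refine Finset.sum_congr rfl fun i _ => ?_
  by_cases h : i = s i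
  · simp only [if_pos h]
  · simp only [if_neg h, Finset.sum_const_zero]

/-- Appendix Example 4 (8-point OTOC reduction identity):
for `U = (|0⟩⟨0|)^{⊗3} ⊗ C + (I₈ − (|0⟩⟨0|)^{⊗3}) ⊗ I`,
`W₁ = W₂ = W₃ = W₄ = X^{(1)}`, `V₁ = X^{(2)}, V₂ = X^{(3)}, V₃ = X^{(2)}, V₄ = X^{(3)}`,
`(1/2^{m+3}) Tr[(U W₁ U† V₁)(U W₂ U† V₂)(U W₃ U† V₃)(U W₄ U† V₄)] = Re(Tr C)/2^m`. -/
theorem eight_point_otoc_reduction (m : ℕ) (hm : 1 ≤ m)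
    (C : Matrix (Fin (2^m)) (Fin (2^m)) ℂ)
    (hC : C ∈ Matrix.unitaryGroup (Fin (2^m)) ℂ) :
    let A := Fin 2 × (Fin 2 × Fin 2)
    let I2 : Matrix (Fin 2) (Fin 2) ℂ := 1
    let Im : Matrix (Fin (2^m)) (Fin (2^m)) ℂ := 1
    let P000 : Matrix A A ℂ := ket0bra0 ⊗ₖ (ket0bra0 ⊗ₖ ket0bra0)
    let U : Matrix (A × Fin (2^m)) (A × Fin (2^m)) ℂ :=
      P000 ⊗ₖ C + ((1 : Matrix A A ℂ) - P000) ⊗ₖ Im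
    let X1 : Matrix (A × Fin (2^m)) (A × Fin (2^m)) ℂ := (sigmaX ⊗ₖ (I2 ⊗ₖ I2)) ⊗ₖ Im
    let X2 : Matrix (A × Fin (2^m)) (A × Fin (2^m)) ℂ := (I2 ⊗ₖ (sigmaX ⊗ₖ I2)) ⊗ₖ Im
    let X3 : Matrix (A × Fin (2^m)) (A × Fin (2^m)) ℂ := (I2 ⊗ₖ (I2 ⊗ₖ sigmaX)) ⊗ₖ Im
    (1 / (2:ℂ)^(m+3)) *
        Matrix.trace
          ((U * X1 * Uᴴ * X2) * (U * X1 * Uᴴ * X3) * (U * X1 * Uᴴ * X2) * (U * X1 * Uᴴ * X3))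
      = ((Matrix.trace C).re : ℂ) / (2:ℂ)^m := by
  intro A I2 Im P000 U X1 X2 X3
  let d : Fin 2 × Fin 2 × Fin 2 → Matrix (Fin (2^m)) (Fin (2^m)) ℂ := fun a => if a = (0, 0, 0) then C else 1
  have hU : U = monoB id d := by
    ext ⟨⟨a, b, c⟩, x⟩ ⟨⟨a', b', c'⟩, y⟩
    fin_cases a <;> fin_cases b <;> fin_cases c <;> fin_cases a' <;> fin_cases b' <;>
      fin_cases c' <;> simp [U, P000, Im, monoB, d, ket0bra0, Matrix.one_apply]
  have hU' : Uᴴ = monoB id (fun a => (d a)ᴴ) := by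
    rw [hU]
    ext ⟨a, x⟩ ⟨b, y⟩
    by_cases h : a = b
    · subst h
      simp [monoB]
    · simp [monoB, h, Ne.symm h]
  have hX1 : X1 = monoB (fun a => (1 - a.1, a.2)) (fun _ => 1) := by
    ext ⟨⟨a, b, c⟩, x⟩ ⟨⟨a', b', c'⟩, y⟩
    fin_cases a <;> fin_cases b <;> fin_cases c <;> fin_cases a' <;> fin_cases b' <;>
      fin_cases c' <;> simp [X1, I2, Im, monoB, sigmaX]
  have hX2 : X2 = monoB (fun a => (a.1, 1 - a.2.1, a.2.2)) (fun _ => 1) := by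
    ext ⟨⟨a, b, c⟩, x⟩ ⟨⟨a', b', c'⟩, y⟩
    fin_cases a <;> fin_cases b <;> fin_cases c <;> fin_cases a' <;> fin_cases b' <;>
      fin_cases c' <;> simp [X2, I2, Im, monoB, sigmaX]
  have hX3 : X3 = monoB (fun a => (a.1, a.2.1, 1 - a.2.2)) (fun _ => 1) := by
    ext ⟨⟨a, b, c⟩, x⟩ ⟨⟨a', b', c'⟩, y⟩
    fin_cases a <;> fin_cases b <;> fin_cases c <;> fin_cases a' <;> fin_cases b' <;>
      fin_cases c' <;> simp [X3, I2, Im, monoB, sigmaX]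
  have key : Matrix.trace
      ((U * X1 * Uᴴ * X2) * (U * X1 * Uᴴ * X3) * (U * X1 * Uᴴ * X2) * (U * X1 * Uᴴ * X3))
      = 4 * (Matrix.trace C + star (Matrix.trace C)) := by
    rw [hU', hU, hX1, hX2, hX3]
    simp only [monoB_mul, monoB_trace]
    simp [A, d, Fintype.sum_prod_type, Fin.sum_univ_two, Matrix.trace_conjTranspose]
    ring
  rw [key]
  have h2 : Matrix.trace C + star (Matrix.trace C) = 2 * ((Matrix.trace C).re : ℂ) := by
    have := Complex.add_conj (Matrix.trace C)
    simpa using this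
  rw [h2, pow_add]
  field_simp
  norm_num
end

section
/- Let m ≥ 1 and let C be a unitary 2^m × 2^m complex matrix. Define the 2^{m+2} × 2^{m+2} unitary U = (|0⟩⟨0| ⊗ |0⟩⟨0|) ⊗ C + (I_4 − |0⟩⟨0| ⊗ |0⟩⟨0|) ⊗ I_{2^m}. For P ∈ {I_2, σx, σy, σz}, write P^{(1)} = P ⊗ I_2 ⊗ I_{2^m} and P^{(2)} = I_2 ⊗ P ⊗ I_{2^m}. Then the average bipartite 4-point OTOC satisfies (1/16) · Σ_{W, V ∈ {I_2, σx, σy, σz}} (1/2^{m+2}) · Tr[(U W^{(1)} U†) V^{(2)} (U W^{(1)} U†) V^{(2)}] = 3/4 + (1/4) · Re(Tr C)/2^m. -/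
open Matrix
open scoped Kronecker

/-- The single-qubit Pauli basis: `![I₂, σx, σy, σz]`. -/
noncomputable def pauli : Fin 4 → Matrix (Fin 2) (Fin 2) ℂ :=
  ![1, !![0, 1; 1, 0], !![0, -Complex.I; Complex.I, 0], !![1, 0; 0, -1]]

lemma pauli_sum (i j : Fin 2) : ∑ w : Fin 4, pauli w i j * pauli w j i = 2 := by
  fin_cases i <;> fin_cases j <;> simp [pauli, Fin.sum_univ_four] <;> norm_num

/-- Block matrices assembled into a big matrix. -/
def bcomp {n : Type} (M : Matrix (Fin 2 × Fin 2) (Fin 2 × Fin 2) (Matrix n n ℂ)) :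
    Matrix ((Fin 2 × Fin 2) × n) ((Fin 2 × Fin 2) × n) ℂ :=
  Matrix.of fun a b => M a.1 b.1 a.2 b.2

lemma bcomp_apply {n : Type} (M : Matrix (Fin 2 × Fin 2) (Fin 2 × Fin 2) (Matrix n n ℂ))
    (a b : (Fin 2 × Fin 2) × n) : bcomp M a b = M a.1 b.1 a.2 b.2 := rfl

lemma bcomp_mul {n : Type} [Fintype n]
    (M N : Matrix (Fin 2 × Fin 2) (Fin 2 × Fin 2) (Matrix n n ℂ)) :
    bcomp M * bcomp N = bcomp (M * N) := by
  ext ⟨a, x⟩ ⟨b, y⟩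
  simp [bcomp_apply, Matrix.mul_apply, Fintype.sum_prod_type, Matrix.sum_apply]

lemma bcomp_trace {n : Type} [Fintype n]
    (M : Matrix (Fin 2 × Fin 2) (Fin 2 × Fin 2) (Matrix n n ℂ)) :
    (bcomp M).trace = ∑ i, (M i i).trace := by
  simp [bcomp_apply, Matrix.trace, Fintype.sum_prod_type]

lemma otoc_term {n : Type} [Fintype n] [DecidableEq n] (D : Fin 2 × Fin 2 → Matrix n n ℂ)
    (U : Matrix ((Fin 2 × Fin 2) × n) ((Fin 2 × Fin 2) × n) ℂ)
    (hU : U = bcomp (Matrix.diagonal D)) (W V : Matrix (Fin 2) (Fin 2) ℂ) :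
    Matrix.trace ((U * ((W ⊗ₖ (1 : Matrix (Fin 2) (Fin 2) ℂ)) ⊗ₖ (1 : Matrix n n ℂ)) * Uᴴ)
      * (((1 : Matrix (Fin 2) (Fin 2) ℂ) ⊗ₖ V) ⊗ₖ (1 : Matrix n n ℂ))
      * (U * ((W ⊗ₖ (1 : Matrix (Fin 2) (Fin 2) ℂ)) ⊗ₖ (1 : Matrix n n ℂ)) * Uᴴ)
      * (((1 : Matrix (Fin 2) (Fin 2) ℂ) ⊗ₖ V) ⊗ₖ (1 : Matrix n n ℂ)))
    = ∑ i, ∑ i', ∑ j, ∑ k, (W i i' * W i' i) * (V j k * V k j) *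
        (D (i, j) * (D (i', j))ᴴ * (D (i', k) * (D (i, k))ᴴ)).trace := by
  have hW : ((W ⊗ₖ (1 : Matrix (Fin 2) (Fin 2) ℂ)) ⊗ₖ (1 : Matrix n n ℂ))
      = bcomp (Matrix.of fun a b => (W a.1 b.1 * (1 : Matrix (Fin 2) (Fin 2) ℂ) a.2 b.2) •
        (1 : Matrix n n ℂ)) := by
    ext ⟨a, x⟩ ⟨b, y⟩
    simp [bcomp_apply]
  have hV : (((1 : Matrix (Fin 2) (Fin 2) ℂ) ⊗ₖ V) ⊗ₖ (1 : Matrix n n ℂ))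
      = bcomp (Matrix.of fun a b => ((1 : Matrix (Fin 2) (Fin 2) ℂ) a.1 b.1 * V a.2 b.2) •
        (1 : Matrix n n ℂ)) := by
    ext ⟨a, x⟩ ⟨b, y⟩
    simp [bcomp_apply]
  have hUH : Uᴴ = bcomp (Matrix.diagonal fun a => (D a)ᴴ) := by
    subst hU
    ext ⟨a, x⟩ ⟨b, y⟩
    by_cases h : a = b
    · subst h; simp [bcomp_apply]
    · simp [bcomp_apply, Matrix.diagonal_apply_ne _ h,
        Matrix.diagonal_apply_ne _ (Ne.symm h)]
  rw [hW, hV, hUH, hU]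
  simp only [bcomp_mul]
  rw [bcomp_trace]
  have hA : (Matrix.diagonal D * (Matrix.of fun a b : Fin 2 × Fin 2 =>
      (W a.1 b.1 * (1 : Matrix (Fin 2) (Fin 2) ℂ) a.2 b.2) • (1 : Matrix n n ℂ))
      * Matrix.diagonal fun a => (D a)ᴴ)
      = Matrix.of fun a b => (W a.1 b.1 * (1 : Matrix (Fin 2) (Fin 2) ℂ) a.2 b.2) •
        (D a * (D b)ᴴ) := by
    ext a b : 2
    simp [Matrix.mul_diagonal, Matrix.diagonal_mul]
  rw [hA]
  simp only [Matrix.mul_apply, Matrix.of_apply, Fintype.sum_prod_type, Fin.sum_univ_two,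
    Matrix.one_apply]
  simp [Matrix.trace_add, smul_smul]
  ring

lemma pauli_swap (c : ℂ) (T : Fin 2 → Fin 2 → Fin 2 → Fin 2 → ℂ) :
    ∑ w : Fin 4, ∑ v : Fin 4, c *
      (∑ i, ∑ i', ∑ j, ∑ k, (pauli w i i' * pauli w i' i) * (pauli v j k * pauli v k j) *
        T i i' j k)
      = c * ∑ i, ∑ i', ∑ j, ∑ k, 2 * 2 * T i i' j k := by
  have hp := pauli_sum
  generalize pauli = p at hp ⊢
  simp only [← Finset.mul_sum]
  congr 1
  simp only [Fin.sum_univ_two, Finset.sum_add_distrib, ← Finset.sum_mul, ← Finset.mul_sum, hp]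
  ring

/-- Corollary 1 reduction identity: for
`U = |00⟩⟨00| ⊗ C + (I₄ − |00⟩⟨00|) ⊗ I`, the average bipartite 4-point OTOC,
averaged over `W ∈ {I,σx,σy,σz}` on ancilla qubit 1 and `V ∈ {I,σx,σy,σz}` on
ancilla qubit 2, satisfies
`(1/16) ∑_{W,V} (1/2^{m+2}) Tr[(U W^{(1)} U†) V^{(2)} (U W^{(1)} U†) V^{(2)}]
  = 3/4 + (1/4)·Re(Tr C)/2^m`. -/
theorem average_bipartite_otoc_reduction (m : ℕ) (hm : 1 ≤ m)
    (C : Matrix (Fin (2^m)) (Fin (2^m)) ℂ)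
    (hC : C ∈ Matrix.unitaryGroup (Fin (2^m)) ℂ) :
    let I2 : Matrix (Fin 2) (Fin 2) ℂ := 1
    let Im : Matrix (Fin (2^m)) (Fin (2^m)) ℂ := 1
    let P00 : Matrix (Fin 2 × Fin 2) (Fin 2 × Fin 2) ℂ := ket0bra0 ⊗ₖ ket0bra0
    let U : Matrix ((Fin 2 × Fin 2) × Fin (2^m)) ((Fin 2 × Fin 2) × Fin (2^m)) ℂ :=
      P00 ⊗ₖ C + ((1 : Matrix (Fin 2 × Fin 2) (Fin 2 × Fin 2) ℂ) - P00) ⊗ₖ Im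
    let Wfull : Fin 4 → Matrix ((Fin 2 × Fin 2) × Fin (2^m)) ((Fin 2 × Fin 2) × Fin (2^m)) ℂ :=
      fun w => (pauli w ⊗ₖ I2) ⊗ₖ Im
    let Vfull : Fin 4 → Matrix ((Fin 2 × Fin 2) × Fin (2^m)) ((Fin 2 × Fin 2) × Fin (2^m)) ℂ :=
      fun v => (I2 ⊗ₖ pauli v) ⊗ₖ Im
    (1/16 : ℂ) * ∑ w : Fin 4, ∑ v : Fin 4,
        (1 / (2:ℂ)^(m+2)) *
          Matrix.trace ((U * Wfull w * Uᴴ) * Vfull v * (U * Wfull w * Uᴴ) * Vfull v)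
      = 3/4 + (1/4) * (((Matrix.trace C).re : ℂ) / (2:ℂ)^m) := by
  intro I2 Im P00 U Wfull Vfull
  let D : Fin 2 × Fin 2 → Matrix (Fin (2^m)) (Fin (2^m)) ℂ := fun a => if a = (0, 0) then C else 1
  have hU : U = bcomp (Matrix.diagonal D) := by
    ext ⟨⟨a, b⟩, x⟩ ⟨⟨c, d⟩, y⟩
    fin_cases a <;> fin_cases b <;> fin_cases c <;> fin_cases d <;>
      simp [U, P00, Im, D, bcomp_apply, ket0bra0, Matrix.diagonal, Matrix.one_apply]
  have h1 : C * Cᴴ = 1 := Matrix.mem_unitaryGroup_iff.mp hC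
  have h2 : Cᴴ * C = 1 := Matrix.mem_unitaryGroup_iff'.mp hC
  have key : ∀ w v, Matrix.trace ((U * Wfull w * Uᴴ) * Vfull v * (U * Wfull w * Uᴴ) * Vfull v)
      = _ := fun w v => otoc_term D U hU (pauli w) (pauli v)
  simp only [key]
  have hs : ∑ w : Fin 4, ∑ v : Fin 4, (1 / (2:ℂ)^(m+2)) *
      (∑ i, ∑ i', ∑ j, ∑ k, (pauli w i i' * pauli w i' i) * (pauli v j k * pauli v k j) *
        (D (i, j) * (D (i', j))ᴴ * (D (i', k) * (D (i, k))ᴴ)).trace)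
      = (1 / (2:ℂ)^(m+2)) * ∑ i, ∑ i', ∑ j, ∑ k, 2 * 2 *
        (D (i, j) * (D (i', j))ᴴ * (D (i', k) * (D (i, k))ᴴ)).trace := 
      pauli_swap _ (fun i i' j k => (D (i, j) * (D (i', j))ᴴ * (D (i', k) * (D (i, k))ᴴ)).trace)
  rw [hs]
  have hre : (((Matrix.trace C).re : ℝ) : ℂ) = (C.trace + Cᴴ.trace) / 2 := by
    rw [Matrix.trace_conjTranspose, Complex.re_eq_add_conj]; rfl
  rw [hre]
  have h6 : (2:ℂ)^m ≠ 0 := pow_ne_zero _ two_ne_zero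
  simp [Fin.sum_univ_two, D, h1, h2, Matrix.trace_one]
  have hc : (starRingEnd ℂ) 2 = 2 := Complex.conj_ofNat 2
  try rw [hc]
  field_simp
  ring
end

section
/- Let n ≥ 1, let k ≥ 2 be an even integer, let U be a unitary 2^n × 2^n complex matrix, and let W_1, …, W_k, V_1, …, V_k be Hermitian unitary 2^n × 2^n complex matrices. With Λ₀(O) = |0⟩⟨0| ⊗ O + |1⟩⟨1| ⊗ I_{2^n}, Λ₁(O) = |0⟩⟨0| ⊗ I_{2^n} + |1⟩⟨1| ⊗ O, Ũ = I_2 ⊗ U, and H = (1/√2)[[1,1],[1,−1]], define for j ∈ {1, …, k/2} the factor F_j = Λ₁(V_{k−j+1}) · Ũ · Λ₁(W_{k−j+1}) · Λ₀(W_j) · Ũ† · Λ₀(V_j), and set C_T = (H ⊗ I_{2^n}) · F_{k/2} · F_{k/2−1} ⋯ F_1 · (H ⊗ I_{2^n}). Then Tr[(|0⟩⟨0| ⊗ I_{2^n}) · C_T · (|0⟩⟨0| ⊗ (I_{2^n}/2^n)) · C_T†] = 1/2 + (1/2) · Re[(1/2^n) · Tr[(U W_{k/2} U† V_{k/2})(U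 W_{k/2−1} U† V_{k/2−1}) ⋯ (U W_1 U† V_1) · (U W_k U† V_k)(U W_{k−1} U† V_{k−1}) ⋯ (U W_{k/2+1} U† V_{k/2+1})]]. -/
open Matrix
open scoped Kronecker

/-- The Hadamard matrix `H = (1/√2)[[1,1],[1,−1]]`. -/
noncomputable def hadamard : Matrix (Fin 2) (Fin 2) ℂ :=
  ((Real.sqrt 2 : ℂ))⁻¹ • !![1, 1; 1, -1]

lemma dq_mul {N : Type*} [Fintype N] [DecidableEq N] (A B C D : Matrix N N ℂ) :
    (ket0bra0 ⊗ₖ A + ket1bra1 ⊗ₖ B) * (ket0bra0 ⊗ₖ C + ket1bra1 ⊗ₖ D)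
      = ket0bra0 ⊗ₖ (A * C) + ket1bra1 ⊗ₖ (B * D) := by
  have h00 : ket0bra0 * ket0bra0 = ket0bra0 := by
    ext i j; fin_cases i <;> fin_cases j <;> simp [ket0bra0]
  have h01 : ket0bra0 * ket1bra1 = 0 := by
    ext i j; fin_cases i <;> fin_cases j <;> simp [ket0bra0, ket1bra1]
  have h10 : ket1bra1 * ket0bra0 = 0 := by
    ext i j; fin_cases i <;> fin_cases j <;> simp [ket0bra0, ket1bra1]
  have h11 : ket1bra1 * ket1bra1 = ket1bra1 := by
    ext i j; fin_cases i <;> fin_cases j <;> simp [ket1bra1]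
  simp only [add_mul, mul_add, ← Matrix.mul_kronecker_mul, h00, h01, h10, h11,
    Matrix.zero_kronecker, add_zero, zero_add]

lemma dq_add : ket0bra0 + ket1bra1 = 1 := by
  ext i j; fin_cases i <;> fin_cases j <;> simp [ket0bra0, ket1bra1]

lemma dq_diag {N : Type*} [Fintype N] [DecidableEq N] (A : Matrix N N ℂ) :
    (1 : Matrix (Fin 2) (Fin 2) ℂ) ⊗ₖ A = ket0bra0 ⊗ₖ A + ket1bra1 ⊗ₖ A := by
  rw [← dq_add, Matrix.add_kronecker]

lemma dq_list {N : Type*} [Fintype N] [DecidableEq N] (A B : ℕ → Matrix N N ℂ) (l : List ℕ) :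
    (l.map (fun i => ket0bra0 ⊗ₖ A i + ket1bra1 ⊗ₖ B i)).prod
      = ket0bra0 ⊗ₖ (l.map A).prod + ket1bra1 ⊗ₖ (l.map B).prod := by
  induction l with
  | nil => simp [← dq_diag]
  | cons a l ih => simp only [List.map_cons, List.prod_cons, ih, dq_mul]

lemma dq_rev {N : Type*} [Fintype N] [DecidableEq N] (g : ℕ → Matrix N N ℂ) (m : ℕ) :
    ((List.range m).map (fun i => (g i)ᴴ)).prodᴴ
      = ((List.range m).map (fun i => g (m - 1 - i))).prod := by
  rw [Matrix.conjTranspose_list_prod]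
  congr 1
  apply List.ext_getElem
  · simp
  · intro i h1 h2
    simp

lemma dq_unit {N : Type*} [Fintype N] [DecidableEq N] (A : ℕ → Matrix N N ℂ) (l : List ℕ)
    (h : ∀ i ∈ l, A i ∈ Matrix.unitaryGroup N ℂ) :
    (l.map A).prod * (l.map A).prodᴴ = 1 := by
  have : (l.map A).prod ∈ Matrix.unitaryGroup N ℂ := by
    apply Submonoid.list_prod_mem
    intro x hx
    obtain ⟨i, hi, rfl⟩ := List.mem_map.1 hx
    exact h i hi
  exact Matrix.mem_unitaryGroup_iff.1 this

lemma dq_sqrt : ((Real.sqrt 2 : ℂ))⁻¹ * ((Real.sqrt 2 : ℂ))⁻¹ = 1 / 2 := by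
  rw [← mul_inv, ← Complex.ofReal_mul, Real.mul_self_sqrt (by norm_num)]; norm_num

lemma dq_P : hadamard * ket0bra0 * hadamard = (1/2 : ℂ) • !![1, 1; 1, 1] := by
  unfold _root_.hadamard ket0bra0
  rw [Matrix.smul_mul, Matrix.smul_mul, Matrix.mul_smul, smul_smul, dq_sqrt]
  congr 1
  ext i j; fin_cases i <;> fin_cases j <;> simp

lemma dq_Q : hadamard * ket1bra1 * hadamard = (1/2 : ℂ) • !![1, -1; -1, 1] := by
  unfold _root_.hadamard ket1bra1
  rw [Matrix.smul_mul, Matrix.smul_mul, Matrix.mul_smul, smul_smul, dq_sqrt]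
  congr 1
  ext i j; fin_cases i <;> fin_cases j <;> simp

lemma dq_final {N : Type*} [Fintype N] [DecidableEq N] (A B : Matrix N N ℂ) (c : ℂ)
    (hA : A * Aᴴ = 1) (hB : B * Bᴴ = 1) (hc : c * (Fintype.card N : ℂ) = 1)
    (hc' : star c = c) :
    Matrix.trace ((ket0bra0 ⊗ₖ (1 : Matrix N N ℂ)) *
      ((hadamard ⊗ₖ (1 : Matrix N N ℂ)) * (ket0bra0 ⊗ₖ A + ket1bra1 ⊗ₖ B) *
        (hadamard ⊗ₖ (1 : Matrix N N ℂ))) * (ket0bra0 ⊗ₖ (c • (1 : Matrix N N ℂ))) *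
      ((hadamard ⊗ₖ (1 : Matrix N N ℂ)) * (ket0bra0 ⊗ₖ A + ket1bra1 ⊗ₖ B) *
        (hadamard ⊗ₖ (1 : Matrix N N ℂ)))ᴴ)
      = 1/2 + (1/2) * (((c * Matrix.trace (A * Bᴴ)).re : ℝ) : ℂ) := by
  have e : (hadamard ⊗ₖ (1 : Matrix N N ℂ)) * (ket0bra0 ⊗ₖ A + ket1bra1 ⊗ₖ B) *
        (hadamard ⊗ₖ (1 : Matrix N N ℂ))
      = ((1/2 : ℂ) • !![1, 1; 1, 1]) ⊗ₖ A + ((1/2 : ℂ) • !![1, -1; -1, 1]) ⊗ₖ B := by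
    simp only [add_mul, mul_add, ← Matrix.mul_kronecker_mul, one_mul, mul_one, dq_P, dq_Q]
  rw [e]
  have hBA : Matrix.trace (B * Aᴴ) = star (Matrix.trace (A * Bᴴ)) := by
    rw [← Matrix.trace_conjTranspose, Matrix.conjTranspose_mul, Matrix.conjTranspose_conjTranspose]
  have hre : (((c * Matrix.trace (A * Bᴴ)).re : ℝ) : ℂ)
      = (c * Matrix.trace (A * Bᴴ) + c * star (Matrix.trace (A * Bᴴ))) / 2 := by
    rw [Complex.re_eq_add_conj, map_mul]
    have : (starRingEnd ℂ) c = c := hc'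
    rw [this]; rfl
  rw [hre]
  simp only [Matrix.conjTranspose_add, Matrix.conjTranspose_kronecker, add_mul, mul_add,
    ← Matrix.mul_kronecker_mul, one_mul, Matrix.mul_smul, Matrix.smul_mul, mul_one,
    Matrix.trace_add, Matrix.trace_kronecker, Matrix.trace_smul, hA, hB, hBA, Matrix.trace_one]
  simp [ket0bra0, Matrix.trace_fin_two, Matrix.vecMul, dotProduct, Fin.sum_univ_two]
  have h2 : (starRingEnd ℂ) 2 = 2 := Complex.conj_ofNat 2
  simp only [h2]
  linear_combination (1/2) * hc

/-- Lemma 2 circuit identity (Figure 2): for even `k ≥ 2`, unitary `U`, Hermitian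
unitary probes `W_1,…,W_k, V_1,…,V_k`, with factors
`F_j = Λ₁(V_{k−j+1})·Ũ·Λ₁(W_{k−j+1})·Λ₀(W_j)·Ũ†·Λ₀(V_j)` and
`C_T = (H ⊗ I)·F_{k/2}·F_{k/2−1}⋯F_1·(H ⊗ I)`, the DQC1 outcome-0 probability
`Tr[(|0⟩⟨0| ⊗ I)·C_T·(|0⟩⟨0| ⊗ I/2^n)·C_T†]` equals
`1/2 + (1/2)·Re[(1/2^n)·Tr[(U W_{k/2} U† V_{k/2})⋯(U W_1 U† V_1)·
  (U W_k U† V_k)⋯(U W_{k/2+1} U† V_{k/2+1})]]`. -/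
theorem dqc1_otoc_circuit_identity (n k : ℕ) (hn : 1 ≤ n) (hk : 2 ≤ k) (hkeven : Even k)
    (U : Matrix (Fin (2^n)) (Fin (2^n)) ℂ)
    (hU : U ∈ Matrix.unitaryGroup (Fin (2^n)) ℂ)
    (W V : ℕ → Matrix (Fin (2^n)) (Fin (2^n)) ℂ)
    (hW : ∀ j, 1 ≤ j → j ≤ k → (W j)ᴴ = W j ∧ W j * W j = 1)
    (hV : ∀ j, 1 ≤ j → j ≤ k → (V j)ᴴ = V j ∧ V j * V j = 1) :
    let IN : Matrix (Fin (2^n)) (Fin (2^n)) ℂ := 1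
    let Λ₀ : Matrix (Fin (2^n)) (Fin (2^n)) ℂ →
        Matrix (Fin 2 × Fin (2^n)) (Fin 2 × Fin (2^n)) ℂ :=
      fun O => ket0bra0 ⊗ₖ O + ket1bra1 ⊗ₖ IN
    let Λ₁ : Matrix (Fin (2^n)) (Fin (2^n)) ℂ →
        Matrix (Fin 2 × Fin (2^n)) (Fin 2 × Fin (2^n)) ℂ :=
      fun O => ket0bra0 ⊗ₖ IN + ket1bra1 ⊗ₖ O
    let Ut : Matrix (Fin 2 × Fin (2^n)) (Fin 2 × Fin (2^n)) ℂ :=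
      (1 : Matrix (Fin 2) (Fin 2) ℂ) ⊗ₖ U
    let F : ℕ → Matrix (Fin 2 × Fin (2^n)) (Fin 2 × Fin (2^n)) ℂ :=
      fun j => Λ₁ (V (k - j + 1)) * Ut * Λ₁ (W (k - j + 1)) * Λ₀ (W j) * Utᴴ * Λ₀ (V j)
    let CT : Matrix (Fin 2 × Fin (2^n)) (Fin 2 × Fin (2^n)) ℂ :=
      (hadamard ⊗ₖ IN) * ((List.range (k/2)).map (fun i => F (k/2 - i))).prod * (hadamard ⊗ₖ IN)
    let G : ℕ → Matrix (Fin (2^n)) (Fin (2^n)) ℂ := fun j => U * W j * Uᴴ * V j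
    Matrix.trace ((ket0bra0 ⊗ₖ IN) * CT * (ket0bra0 ⊗ₖ (((2:ℂ)^n)⁻¹ • IN)) * CTᴴ)
      = 1/2 + (1/2) *
          ((((((2:ℂ)^n)⁻¹) *
              Matrix.trace
                (((List.range (k/2)).map (fun i => G (k/2 - i)) ++
                  (List.range (k/2)).map (fun i => G (k - i))).prod)).re : ℂ)) := by
  intro IN Λ₀ Λ₁ Ut F CT G
  obtain ⟨m, rfl⟩ := hkeven
  have hm : (m + m) / 2 = m := by omega
  have hUu : U * Uᴴ = 1 := Matrix.mem_unitaryGroup_iff.1 hU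
  have hUs : Uᴴ ∈ Matrix.unitaryGroup (Fin (2^n)) ℂ := Unitary.star_mem hU
  have hGu : ∀ j, 1 ≤ j → j ≤ m + m → G j ∈ Matrix.unitaryGroup (Fin (2^n)) ℂ := by
    intro j h1 h2
    have hw : W j ∈ Matrix.unitaryGroup (Fin (2^n)) ℂ := by
      rw [Matrix.mem_unitaryGroup_iff, Matrix.star_eq_conjTranspose, (hW j h1 h2).1]
      exact (hW j h1 h2).2
    have hv : V j ∈ Matrix.unitaryGroup (Fin (2^n)) ℂ := by
      rw [Matrix.mem_unitaryGroup_iff, Matrix.star_eq_conjTranspose, (hV j h1 h2).1]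
      exact (hV j h1 h2).2
    exact mul_mem (mul_mem (mul_mem hU hw) hUs) hv
  have hF : ∀ j, 1 ≤ j → j ≤ m + m →
      F j = ket0bra0 ⊗ₖ G j + ket1bra1 ⊗ₖ (G (m + m - j + 1))ᴴ := by
    intro j h1 h2
    have hUt : Utᴴ = (1 : Matrix (Fin 2) (Fin 2) ℂ) ⊗ₖ Uᴴ := by
      simp [Ut, Matrix.conjTranspose_kronecker]
    have hw := (hW (m + m - j + 1) (by omega) (by omega)).1
    have hv := (hV (m + m - j + 1) (by omega) (by omega)).1
    simp only [F, hUt]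
    simp only [Ut, Λ₀, Λ₁, IN, G, dq_diag, dq_mul, Matrix.conjTranspose_mul,
      Matrix.conjTranspose_conjTranspose, hw, hv, one_mul, mul_one, mul_assoc]
  have hP : ((List.range m).map (fun i => F (m - i))).prod
      = ket0bra0 ⊗ₖ ((List.range m).map (fun i => G (m - i))).prod
        + ket1bra1 ⊗ₖ ((List.range m).map (fun i => (G (m + 1 + i))ᴴ)).prod := by
    rw [← dq_list]
    congr 1
    apply List.map_congr_left
    intro i hi
    have hi := List.mem_range.1 hi
    rw [hF _ (by omega) (by omega)]
    rw [show m + m - (m - i) + 1 = m + 1 + i by omega]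
  have hR : ((List.range m).map (fun i => G (m + m - i))).prod
      = ((List.range m).map (fun i => (G (m + 1 + i))ᴴ)).prodᴴ := by
    rw [dq_rev (fun i => G (m + 1 + i))]
    congr 1
    apply List.map_congr_left
    intro i hi
    have hi := List.mem_range.1 hi
    congr 1
    omega
  simp only [CT, hm]
  rw [hP, List.prod_append, hR]
  apply dq_final
  · apply dq_unit
    intro i hi
    have hi := List.mem_range.1 hi
    exact hGu _ (by omega) (by omega)
  · apply dq_unit
    intro i hi
    have hi := List.mem_range.1 hi
    exact Unitary.star_mem (hGu _ (by omega) (by omega))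
  · simp
  · simp
end
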